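/- arXiv:1807.07619 — 8 statements merged into one kernel-verified Lean document; each statement's English description precedes it below -/
import Mathlib

section
/- Let (V, E, w) be a finite weighted graph with nonnegative weights and let S ⊆ E. Then S contains at least one edge from every broken cycle of (V, E, w) if and only if there exists a solution W of the metric repair problem with supp(W) ⊆ S, i.e., a modification supported inside S after which the weighted graph has no broken cycle. -/
/-- `e` is the top edge of the broken cycle `c` in the weighted graph `(G, w)`:
`c` is a cycle, `e` is an edge of `c`, and the weight of `e` exceeds the total
weight of the other (bottom) edges of `c`. -/
def IsTopEdgeOf {V : Type*} [DecidableEq V] (G : SimpleGraph V) (w : Sym2 V → ℝ)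
    {u : V} (c : G.Walk u u) (e : Sym2 V) : Prop :=
  c.IsCycle ∧ e ∈ c.edges ∧ ((c.edges.erase e).map w).sum < w e

/-- The weighted graph `(G, w)` has a broken cycle. -/
def HasBrokenCycle {V : Type*} [DecidableEq V] (G : SimpleGraph V)
    (w : Sym2 V → ℝ) : Prop :=
  ∃ (u : V) (c : G.Walk u u) (e : Sym2 V), IsTopEdgeOf G w c e

open SimpleGraph in
theorem SimpleGraph.Walk.exists_append_cons_of_mem_edges {V : Type*} {G : SimpleGraph V}
    {u v : V} (p : G.Walk u v) {e : Sym2 V} (he : e ∈ p.edges) :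
    ∃ (a b : V) (h : G.Adj a b) (q : G.Walk u a) (r : G.Walk b v),
      e = s(a, b) ∧ p = q.append (Walk.cons h r) := by
  induction p with
  | nil => simp at he
  | cons h p ih =>
    rw [Walk.edges_cons, List.mem_cons] at he
    rcases he with rfl | he
    · exact ⟨_, _, h, Walk.nil, p, rfl, rfl⟩
    · obtain ⟨a, b, h', q, r, rfl, rfl⟩ := ih he
      exact ⟨a, b, h', Walk.cons h q, r, rfl, rfl⟩

/-- The total weight of the edges of a walk. -/
def SimpleGraph.Walk.cost {V : Type*} {G : SimpleGraph V} (w : Sym2 V → ℝ) {u v : V}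
    (p : G.Walk u v) : ℝ :=
  (p.edges.map w).sum

namespace SimpleGraph.Walk

variable {V : Type*} {G : SimpleGraph V} {w : Sym2 V → ℝ} {u v x : V}

@[simp] theorem cost_nil : (nil : G.Walk u u).cost w = 0 := by simp [cost]

@[simp] theorem cost_cons (h : G.Adj u v) (p : G.Walk v x) :
    (cons h p).cost w = w s(u, v) + p.cost w := by simp [cost]

@[simp] theorem cost_append (p : G.Walk u v) (q : G.Walk v x) :
    (p.append q).cost w = p.cost w + q.cost w := by simp [cost]

@[simp] theorem cost_reverse (p : G.Walk u v) : p.reverse.cost w = p.cost w := by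
  simp [cost, List.map_reverse, List.sum_reverse]

theorem cost_nonneg (hw : ∀ e ∈ G.edgeSet, 0 ≤ w e) (p : G.Walk u v) : 0 ≤ p.cost w := by
  refine List.sum_nonneg fun y hy => ?_
  obtain ⟨e, he, rfl⟩ := List.mem_map.1 hy
  exact hw e (p.edges_subset_edgeSet he)

theorem le_cost_of_mem_edges (hw : ∀ e ∈ G.edgeSet, 0 ≤ w e) (p : G.Walk u v) {e : Sym2 V}
    (he : e ∈ p.edges) : w e ≤ p.cost w := by
  obtain ⟨a, b, h, q, r, rfl, rfl⟩ := p.exists_append_cons_of_mem_edges he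
  have := q.cost_nonneg hw
  have := r.cost_nonneg hw
  rw [cost_append, cost_cons]
  linarith

theorem cost_bypass_le [DecidableEq V] (hw : ∀ e ∈ G.edgeSet, 0 ≤ w e) (p : G.Walk u v) :
    p.bypass.cost w ≤ p.cost w := by
  obtain ⟨l, hl, hs⟩ :=
    p.bypass_isPath.isTrail.edges_nodup.subperm p.edges_bypass_subset_edges
  have h : (l.map w).sum = p.bypass.cost w := (hl.map w).sum_eq
  rw [← h]
  refine (hs.map w).sum_le_sum fun y hy => ?_
  obtain ⟨e, he, rfl⟩ := List.mem_map.1 hy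
  exact hw e (p.edges_subset_edgeSet he)

theorem cost_congr {w' : Sym2 V → ℝ} (p : G.Walk u v) (h : ∀ e ∈ p.edges, w e = w' e) :
    p.cost w = p.cost w' :=
  congrArg List.sum (List.map_congr_left h)

end SimpleGraph.Walk

/-- The infimum of the costs of the walks joining the two ends of a pair of vertices. -/
noncomputable def SimpleGraph.pathMetric {V : Type*} (G : SimpleGraph V) (w : Sym2 V → ℝ)
    (e : Sym2 V) : ℝ :=
  sInf {y | ∃ (u v : V) (p : G.Walk u v), s(u, v) = e ∧ p.cost w = y}

namespace SimpleGraph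

variable {V : Type*} {G : SimpleGraph V} {w : Sym2 V → ℝ} {u v x : V}

theorem pathMetric_le (hw : ∀ e ∈ G.edgeSet, 0 ≤ w e) (p : G.Walk u v) :
    G.pathMetric w s(u, v) ≤ p.cost w := by
  refine csInf_le ⟨0, ?_⟩ ⟨u, v, p, rfl, rfl⟩
  rintro _ ⟨a, b, q, -, rfl⟩
  exact q.cost_nonneg hw

theorem le_pathMetric (p : G.Walk u v) {y : ℝ} (h : ∀ q : G.Walk u v, y ≤ q.cost w) :
    y ≤ G.pathMetric w s(u, v) := by
  refine le_csInf ⟨_, u, v, p, rfl, rfl⟩ ?_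
  rintro _ ⟨a, b, q, hab, rfl⟩
  rcases Sym2.eq_iff.1 hab with ⟨rfl, rfl⟩ | ⟨rfl, rfl⟩
  · exact h q
  · simpa using h q.reverse

theorem pathMetric_triangle (hw : ∀ e ∈ G.edgeSet, 0 ≤ w e) (p : G.Walk u v)
    (q : G.Walk v x) :
    G.pathMetric w s(u, x) ≤ G.pathMetric w s(u, v) + G.pathMetric w s(v, x) := by
  rw [← sub_le_iff_le_add]
  refine le_pathMetric p fun p' => ?_
  rw [sub_le_comm]
  refine le_pathMetric q fun q' => ?_
  have := pathMetric_le hw (p'.append q')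
  rw [Walk.cost_append] at this
  linarith

theorem pathMetric_le_cost_pathMetric (hw : ∀ e ∈ G.edgeSet, 0 ≤ w e) (p : G.Walk u v) :
    G.pathMetric w s(u, v) ≤ p.cost (G.pathMetric w) := by
  induction p with
  | nil => simpa using pathMetric_le hw Walk.nil
  | cons h p ih =>
    have := pathMetric_triangle hw h.toWalk p
    rw [Walk.cost_cons]
    linarith

end SimpleGraph

open SimpleGraph

theorem IsTopEdgeOf.congr {V : Type*} [DecidableEq V] {G : SimpleGraph V}
    {w w' : Sym2 V → ℝ} {u : V} {c : G.Walk u u} {e : Sym2 V}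
    (h : IsTopEdgeOf G w c e) (hw : ∀ f ∈ c.edges, w f = w' f) : IsTopEdgeOf G w' c e := by
  obtain ⟨hc, he, hlt⟩ := h
  refine ⟨hc, he, ?_⟩
  rwa [← List.map_congr_left fun f hf => hw f (List.mem_of_mem_erase hf), ← hw e he]

/-- A weight function bounded on each edge by the cost of every walk joining its ends
admits no broken cycle. -/
theorem not_hasBrokenCycle_of_le_cost {V : Type*} [DecidableEq V] {G : SimpleGraph V}
    {w : Sym2 V → ℝ} (h : ∀ (u v : V) (p : G.Walk u v), G.Adj u v → w s(u, v) ≤ p.cost w) :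
    ¬ HasBrokenCycle G w := by
  rintro ⟨u, c, e, -, he, hlt⟩
  obtain ⟨a, b, hab, q, r, rfl, rfl⟩ := c.exists_append_cons_of_mem_edges he
  have hperm : (q.append (Walk.cons hab r)).edges.Perm (s(a, b) :: (r.append q).edges) := by
    rw [Walk.edges_append, Walk.edges_append, Walk.edges_cons]
    exact List.perm_middle.trans (List.perm_append_comm.cons _)
  have hperm' := (hperm.erase s(a, b)).map w
  rw [List.erase_cons_head] at hperm'
  rw [hperm'.sum_eq, Sym2.eq_swap] at hlt
  exact hlt.not_ge (h b a (r.append q) hab.symm)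

/-- If `S` meets every broken cycle, an edge outside `S` weighs at most as much as any walk
that avoids `S` and joins its ends. -/
theorem le_cost_of_not_isTopEdgeOf {V : Type*} [DecidableEq V] {G : SimpleGraph V}
    {w : Sym2 V → ℝ} (hw : ∀ e ∈ G.edgeSet, 0 ≤ w e) {S : Set (Sym2 V)}
    (hS : ∀ (u : V) (c : G.Walk u u) (e : Sym2 V), IsTopEdgeOf G w c e → ∃ f ∈ c.edges, f ∈ S)
    {u v : V} (huv : G.Adj u v) (he : s(u, v) ∉ S) (p : G.Walk u v)
    (hp : ∀ f ∈ p.edges, f ∉ S) : w s(u, v) ≤ p.cost w := by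
  refine le_trans ?_ (p.cost_bypass_le hw)
  by_cases hmem : s(u, v) ∈ p.bypass.edges
  · exact p.bypass.le_cost_of_mem_edges hw hmem
  by_contra! hlt
  have hcycle : (Walk.cons huv.symm p.bypass).IsCycle :=
    (Walk.cons_isCycle_iff _ huv.symm).2 ⟨p.bypass_isPath, by rwa [Sym2.eq_swap]⟩
  obtain ⟨f, hf, hfS⟩ := hS v (Walk.cons huv.symm p.bypass) s(v, u)
    ⟨hcycle, by simp, by rwa [Walk.edges_cons, List.erase_cons_head, Sym2.eq_swap]⟩
  rw [Walk.edges_cons, List.mem_cons] at hf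
  rcases hf with rfl | hf
  · exact he (Sym2.eq_swap ▸ hfS)
  · exact hp f (p.edges_bypass_subset_edges hf) hfS

/-- For a finite weighted graph `(V, E, w)` with nonnegative weights
and `S ⊆ E`: `S` contains an edge from every broken cycle if and only if there is a
solution `W` of the metric repair problem supported inside `S`. -/
theorem stmt_0 {V : Type*} [Fintype V] [DecidableEq V]
    (G : SimpleGraph V) (w : Sym2 V → ℝ)
    (hw : ∀ e ∈ G.edgeSet, 0 ≤ w e)
    (S : Set (Sym2 V)) (hS : S ⊆ G.edgeSet) :
    (∀ (u : V) (c : G.Walk u u) (e : Sym2 V),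
        IsTopEdgeOf G w c e → ∃ f ∈ c.edges, f ∈ S) ↔
    (∃ W : Sym2 V → ℝ,
        (∀ e ∈ G.edgeSet, 0 ≤ w e + W e) ∧
        (∀ e ∈ G.edgeSet, W e ≠ 0 → e ∈ S) ∧
        ¬ HasBrokenCycle G (fun e => w e + W e)) := by
  classical
  constructor
  · intro h
    set M : ℝ := ∑ e, |w e|
    have hM : ∀ e, w e ≤ M := fun e =>
      (le_abs_self _).trans
        (Finset.single_le_sum (fun f _ => abs_nonneg (w f)) (Finset.mem_univ e))
    set w₀ : Sym2 V → ℝ := fun e => if e ∈ S then M else w e with hw₀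
    have hw₀_nonneg : ∀ e ∈ G.edgeSet, 0 ≤ w₀ e := by
      intro e he
      by_cases heS : e ∈ S
      · simpa [hw₀, heS] using (hw e he).trans (hM e)
      · simpa [hw₀, heS] using hw e he
    have hd : ∀ e ∈ G.edgeSet, e ∉ S → G.pathMetric w₀ e = w e := by
      intro e he heS
      induction e with | h u v => ?_
      have huv : G.Adj u v := he
      refine le_antisymm ?_ (le_pathMetric huv.toWalk fun p => ?_)
      · simpa [hw₀, heS] using pathMetric_le hw₀_nonneg huv.toWalk
      by_cases hp : ∃ f ∈ p.edges, f ∈ S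
      · obtain ⟨f, hf, hfS⟩ := hp
        have := p.le_cost_of_mem_edges hw₀_nonneg hf
        simp only [hw₀, hfS, if_true] at this
        exact (hM _).trans this
      · push Not at hp
        rw [p.cost_congr (w' := w) fun f hf => by simp [hw₀, hp f hf]]
        exact le_cost_of_not_isTopEdgeOf hw h huv heS p hp
    have hsum : ∀ e ∈ G.edgeSet,
        (w e + if e ∈ S then G.pathMetric w₀ e - w e else 0) = G.pathMetric w₀ e := by
      intro e he
      split_ifs with heS
      · ring
      · rw [hd e he heS, add_zero]
    refine ⟨fun e => if e ∈ S then G.pathMetric w₀ e - w e else 0, ?_, ?_, ?_⟩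
    · intro e he
      rw [hsum e he]
      induction e with | h u v => ?_
      exact le_pathMetric (Adj.toWalk he) fun p => p.cost_nonneg hw₀_nonneg
    · intro e _ hne
      by_contra heS
      simp [heS] at hne
    · refine not_hasBrokenCycle_of_le_cost fun u v p huv => ?_
      rw [p.cost_congr fun f hf => hsum f (p.edges_subset_edgeSet hf)]
      exact (hsum _ huv).trans_le (pathMetric_le_cost_pathMetric hw₀_nonneg p)
  · rintro ⟨W, -, hWS, hW⟩ u c e hc
    by_contra! hcS
    refine hW ⟨u, c, e, hc.congr fun f hf => ?_⟩
    have : W f = 0 := by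
      by_contra hne
      exact hcS f hf (hWS f (c.edges_subset_edgeSet hf) hne)
    rw [this, add_zero]
end

section
/- Let (V, E, w) be a finite weighted graph with nonnegative weights and let S ⊆ E. Then S contains at least one bottom edge from every broken cycle of (V, E, w) if and only if there exists an increase-only solution W of the metric repair problem with supp(W) ⊆ S. -/
open SimpleGraph

section CappedDist

variable {V : Type*}

/-- The possible lengths of a connection from `x` to `y`: the cap `M`, and the total weights of
the walks of `H` from `x` to `y`. -/
def cappedLengths (H : SimpleGraph V) (w : Sym2 V → ℝ) (M : ℝ) (x y : V) : Set ℝ :=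
  insert M (Set.range fun p : H.Walk x y => (p.edges.map w).sum)

/-- The weighted shortest-walk distance in `H`, capped at `M`. -/
noncomputable def cappedDist (H : SimpleGraph V) (w : Sym2 V → ℝ) (M : ℝ) (x y : V) : ℝ :=
  sInf (cappedLengths H w M x y)

variable {H : SimpleGraph V} {w : Sym2 V → ℝ} {M : ℝ}

lemma le_cappedDist {x y : V} {a : ℝ} (hM : a ≤ M)
    (hp : ∀ p : H.Walk x y, a ≤ (p.edges.map w).sum) : a ≤ cappedDist H w M x y := by
  refine le_csInf (Set.insert_nonempty _ _) ?_
  rintro b (rfl | ⟨p, rfl⟩)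
  exacts [hM, hp p]

lemma sum_edges_nonneg (hw : ∀ e ∈ H.edgeSet, 0 ≤ w e) {x y : V} (p : H.Walk x y) :
    0 ≤ (p.edges.map w).sum := by
  refine List.sum_nonneg ?_
  simp only [List.mem_map]
  rintro _ ⟨e, he, rfl⟩
  exact hw e (p.edges_subset_edgeSet he)

lemma bddBelow_cappedLengths (hw : ∀ e ∈ H.edgeSet, 0 ≤ w e) (hM : 0 ≤ M) (x y : V) :
    BddBelow (cappedLengths H w M x y) := by
  refine ⟨0, ?_⟩
  rintro b (rfl | ⟨p, rfl⟩)
  exacts [hM, sum_edges_nonneg hw p]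

lemma cappedDist_le_cap (hw : ∀ e ∈ H.edgeSet, 0 ≤ w e) (hM : 0 ≤ M) (x y : V) :
    cappedDist H w M x y ≤ M :=
  csInf_le (bddBelow_cappedLengths hw hM x y) (Set.mem_insert _ _)

lemma cappedDist_le_walk (hw : ∀ e ∈ H.edgeSet, 0 ≤ w e) (hM : 0 ≤ M) {x y : V}
    (p : H.Walk x y) : cappedDist H w M x y ≤ (p.edges.map w).sum :=
  csInf_le (bddBelow_cappedLengths hw hM x y) (Set.mem_insert_of_mem _ ⟨p, rfl⟩)

lemma cappedDist_nonneg (hw : ∀ e ∈ H.edgeSet, 0 ≤ w e) (hM : 0 ≤ M) (x y : V) :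
    0 ≤ cappedDist H w M x y :=
  le_cappedDist hM (sum_edges_nonneg hw)

lemma cappedDist_self_le (hw : ∀ e ∈ H.edgeSet, 0 ≤ w e) (hM : 0 ≤ M) (x : V) :
    cappedDist H w M x x ≤ 0 := by
  simpa using cappedDist_le_walk hw hM (Walk.nil : H.Walk x x)

lemma cappedDist_comm (H : SimpleGraph V) (w : Sym2 V → ℝ) (M : ℝ) (x y : V) :
    cappedDist H w M x y = cappedDist H w M y x := by
  have key : ∀ x y, cappedLengths H w M x y ⊆ cappedLengths H w M y x := by
    rintro x y b (rfl | ⟨p, rfl⟩)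
    · exact Set.mem_insert _ _
    · exact Set.mem_insert_of_mem _ ⟨p.reverse, by simp⟩
  exact congrArg sInf ((key x y).antisymm (key y x))

lemma cappedDist_triangle (hw : ∀ e ∈ H.edgeSet, 0 ≤ w e) (hM : 0 ≤ M) (x y z : V) :
    cappedDist H w M x z ≤ cappedDist H w M x y + cappedDist H w M y z := by
  rw [← sub_le_iff_le_add]
  refine le_cappedDist ?_ fun p => ?_
  · linarith [cappedDist_le_cap hw hM x z, cappedDist_nonneg hw hM y z]
  rw [sub_le_comm]
  refine le_cappedDist ?_ fun q => ?_
  · linarith [cappedDist_le_cap hw hM x z, sum_edges_nonneg hw p]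
  · have := cappedDist_le_walk hw hM (p.append q)
    rw [Walk.edges_append, List.map_append, List.sum_append] at this
    linarith

/-- The capped distance as a weight function on unordered pairs. -/
noncomputable def cappedWeight (H : SimpleGraph V) (w : Sym2 V → ℝ) (M : ℝ) : Sym2 V → ℝ :=
  Sym2.lift ⟨cappedDist H w M, cappedDist_comm H w M⟩

@[simp]
lemma cappedWeight_mk (x y : V) : cappedWeight H w M s(x, y) = cappedDist H w M x y := rfl

lemma cappedDist_le_sum_cappedWeight (hw : ∀ e ∈ H.edgeSet, 0 ≤ w e) (hM : 0 ≤ M)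
    {G : SimpleGraph V} {x y : V} (p : G.Walk x y) :
    cappedDist H w M x y ≤ (p.edges.map (cappedWeight H w M)).sum := by
  induction p with
  | nil => simpa using cappedDist_self_le hw hM _
  | @cons u v z h p ih =>
    simp only [Walk.edges_cons, List.map_cons, List.sum_cons, cappedWeight_mk]
    linarith [cappedDist_triangle hw hM u v z]

lemma cappedWeight_le_add_sum_erase [DecidableEq V] (hw : ∀ e ∈ H.edgeSet, 0 ≤ w e)
    (hM : 0 ≤ M) {G : SimpleGraph V} {x y : V} (p : G.Walk x y) {e : Sym2 V}
    (he : e ∈ p.edges) :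
    cappedWeight H w M e ≤
      cappedDist H w M x y + ((p.edges.erase e).map (cappedWeight H w M)).sum := by
  induction p with
  | nil => simp at he
  | @cons u v z h p ih =>
    rw [Walk.edges_cons] at he ⊢
    by_cases hev : s(u, v) = e
    · subst hev
      rw [List.erase_cons_head, cappedWeight_mk]
      linarith [cappedDist_triangle hw hM u z v, cappedDist_comm H w M z v,
        cappedDist_le_sum_cappedWeight hw hM p]
    · rw [List.erase_cons_tail (by simpa using hev), List.map_cons, List.sum_cons,
        cappedWeight_mk]
      have := ih ((List.mem_cons.1 he).resolve_left (Ne.symm hev))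
      linarith [cappedDist_triangle hw hM v u z, cappedDist_comm H w M u v]

lemma not_hasBrokenCycle_cappedWeight [DecidableEq V] (hw : ∀ e ∈ H.edgeSet, 0 ≤ w e)
    (hM : 0 ≤ M) (G : SimpleGraph V) : ¬ HasBrokenCycle G (cappedWeight H w M) := by
  rintro ⟨u, c, e, -, he, hlt⟩
  linarith [cappedWeight_le_add_sum_erase hw hM c he, cappedDist_self_le hw hM u]

lemma sum_edges_bypass_le [DecidableEq V] (hw : ∀ e ∈ H.edgeSet, 0 ≤ w e) {x y : V}
    (p : H.Walk x y) : (p.bypass.edges.map w).sum ≤ (p.edges.map w).sum := by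
  obtain ⟨l, hperm, hsub⟩ :=
    p.bypass_isPath.isTrail.edges_nodup.subperm p.edges_bypass_subset_edges
  rw [← (hperm.map w).sum_eq]
  refine (hsub.map w).sum_le_sum ?_
  simp only [List.mem_map]
  rintro _ ⟨e, he, rfl⟩
  exact hw e (p.edges_subset_edgeSet he)

/-- If `S` meets the bottom edges of every broken cycle, then walks avoiding `S` are at least as
long as the edges joining their endpoints. -/
lemma weight_le_sum_of_walk_deleteEdges [DecidableEq V] {G : SimpleGraph V} {S : Set (Sym2 V)}
    (hw : ∀ e ∈ G.edgeSet, 0 ≤ w e)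
    (hcover : ∀ (u : V) (c : G.Walk u u) (e : Sym2 V),
      IsTopEdgeOf G w c e → ∃ f ∈ c.edges, f ≠ e ∧ f ∈ S)
    {x y : V} (hxy : G.Adj x y) (p : (G.deleteEdges S).Walk x y) :
    w s(x, y) ≤ (p.edges.map w).sum := by
  have hle : G.deleteEdges S ≤ G := G.deleteEdges_le S
  have hw' : ∀ e ∈ (G.deleteEdges S).edgeSet, 0 ≤ w e := fun e he =>
    hw e (edgeSet_mono hle he)
  refine le_trans ?_ (sum_edges_bypass_le hw' p)
  have hq : p.bypass.IsPath := p.bypass_isPath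
  generalize p.bypass = q at hq
  by_cases hmem : s(x, y) ∈ q.edges
  · refine List.single_le_sum ?_ _ (List.mem_map_of_mem hmem)
    simp only [List.mem_map]
    rintro _ ⟨e, he, rfl⟩
    exact hw' e (q.edges_subset_edgeSet he)
  · by_contra! hlt
    have hedges : (q.mapLe hle).edges = q.edges := by simp
    have hcyc : (Walk.cons hxy.symm (q.mapLe hle)).IsCycle := by
      rw [Walk.cons_isCycle_iff, hedges, Sym2.eq_swap]
      exact ⟨hq.mapLe hle, hmem⟩
    obtain ⟨f, hf, hne, hfS⟩ := hcover y (Walk.cons hxy.symm (q.mapLe hle)) s(x, y)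
      ⟨hcyc, by simp [Sym2.eq_swap], by
        rw [Walk.edges_cons, hedges, Sym2.eq_swap, List.erase_cons_head]
        exact hlt⟩
    rw [Walk.edges_cons, hedges, Sym2.eq_swap] at hf
    have := q.edges_subset_edgeSet ((List.mem_cons.1 hf).resolve_left hne)
    rw [edgeSet_deleteEdges] at this
    exact this.2 hfS

end CappedDist

/-- For a finite weighted graph `(V, E, w)` with nonnegative weights
and `S ⊆ E`: `S` contains a bottom edge from every broken cycle if and only if there
is an increase-only solution `W` of the metric repair problem supported inside `S`. -/
theorem stmt_1 {V : Type*} [Fintype V] [DecidableEq V]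
    (G : SimpleGraph V) (w : Sym2 V → ℝ)
    (hw : ∀ e ∈ G.edgeSet, 0 ≤ w e)
    (S : Set (Sym2 V)) (hS : S ⊆ G.edgeSet) :
    (∀ (u : V) (c : G.Walk u u) (e : Sym2 V),
        IsTopEdgeOf G w c e → ∃ f ∈ c.edges, f ≠ e ∧ f ∈ S) ↔
    (∃ W : Sym2 V → ℝ,
        (∀ e ∈ G.edgeSet, 0 ≤ W e) ∧
        (∀ e ∈ G.edgeSet, 0 ≤ w e + W e) ∧
        (∀ e ∈ G.edgeSet, W e ≠ 0 → e ∈ S) ∧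
        ¬ HasBrokenCycle G (fun e => w e + W e)) := by
  constructor
  · intro hcover
    obtain ⟨B, hB⟩ := (Set.finite_range w).bddAbove
    have hBw : ∀ e, w e ≤ max B 0 := fun e => (hB ⟨e, rfl⟩).trans (le_max_left _ _)
    have hM : 0 ≤ max B 0 := le_max_right _ _
    generalize max B 0 = M at hBw hM
    have hw' : ∀ e ∈ (G.deleteEdges S).edgeSet, 0 ≤ w e := fun e he =>
      hw e (edgeSet_mono (G.deleteEdges_le S) he)
    have hge : ∀ e ∈ G.edgeSet, w e ≤ cappedWeight (G.deleteEdges S) w M e := by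
      rintro ⟨x, y⟩ hxy
      exact le_cappedDist (hBw _) (weight_le_sum_of_walk_deleteEdges hw hcover hxy)
    refine ⟨fun e => cappedWeight (G.deleteEdges S) w M e - w e,
      fun e he => sub_nonneg.2 (hge e he), fun e he => ?_, fun e he hne => ?_, ?_⟩
    · linarith [hge e he, hw e he]
    · by_contra heS
      refine hne (sub_eq_zero.2 (le_antisymm ?_ (hge e he)))
      induction e with | _ x y
      have hadj : (G.deleteEdges S).Adj x y := deleteEdges_adj.2 ⟨he, heS⟩
      simpa using cappedDist_le_walk hw' hM hadj.toWalk
    · simpa using not_hasBrokenCycle_cappedWeight hw' hM G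
  · rintro ⟨W, hW, -, hsupp, hmetric⟩ u c e ⟨hc, he, hlt⟩
    by_contra! hnone
    refine hmetric ⟨u, c, e, hc, he, ?_⟩
    have hbottom : (c.edges.erase e).map (fun f => w f + W f) = (c.edges.erase e).map w := by
      refine List.map_congr_left fun f hf => ?_
      have hf' := hc.isTrail.edges_nodup.mem_erase_iff.1 hf
      have : W f = 0 := by
        by_contra hWf
        exact hnone f hf'.2 hf'.1 (hsupp f (c.edges_subset_edgeSet hf'.2) hWf)
      rw [this, add_zero]
    rw [hbottom]
    linarith [hW e (c.edges_subset_edgeSet he)]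
end

section
/- Let (V, E, w) be a finite weighted graph with nonnegative weights and let S ⊆ E. If the graph (V, E \ S) obtained by deleting the edges of S is connected, then the set of weight functions w' : E → ℝ such that w'(e) ≥ 0 for all e ∈ E, w'(e) = w(e) for every e ∉ S, and the weighted graph (V, E, w') has no broken cycle, is a compact subset of ℝ^E. -/
theorem continuous_sum_map_eval {α : Type*} (l : List α) :
    Continuous fun f : α → ℝ => (l.map f).sum := by
  induction l with
  | nil => simpa using continuous_const
  | cons a l ih => simpa using
      show Continuous fun f : α → ℝ => f a + (l.map f).sum from (continuous_apply a).add ih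

theorem isClosed_setOf_not_hasBrokenCycle {V : Type*} [DecidableEq V] (G : SimpleGraph V) :
    IsClosed {w : Sym2 V → ℝ | ¬ HasBrokenCycle G w} := by
  rw [← isOpen_compl_iff]
  simp only [Set.compl_ofPred, not_not, HasBrokenCycle, IsTopEdgeOf, Set.ofPred_exists]
  refine isOpen_iUnion fun u => isOpen_iUnion fun c => isOpen_iUnion fun e => ?_
  by_cases h : c.IsCycle ∧ e ∈ c.edges
  · simpa [h.1, h.2] using
      isOpen_lt (continuous_sum_map_eval (c.edges.erase e)) (continuous_apply e)
  · convert isOpen_empty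
    ext w
    simp only [Set.mem_ofPred_eq, Set.mem_empty_iff_false, iff_false]
    exact fun hw => h ⟨hw.1, hw.2.1⟩

/-- If deleting `S` leaves `G` connected, then for every edge of `G` in `S` there is a list of pairs
avoiding `S` whose total weight bounds the weight of that edge, whenever there is no broken cycle.
The list does not depend on the weights. -/
theorem exists_edges_sum_bound {V : Type*} [DecidableEq V] (G : SimpleGraph V)
    (S : Set (Sym2 V)) (hconn : (G.deleteEdges S).Connected) {e : Sym2 V}
    (heG : e ∈ G.edgeSet) (heS : e ∈ S) :
    ∃ l : List (Sym2 V), (∀ f ∈ l, f ∉ S) ∧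
      ∀ w : Sym2 V → ℝ, ¬ HasBrokenCycle G w → w e ≤ (l.map w).sum := by
  induction e with | h a b => ?_
  obtain ⟨p, hp⟩ := (hconn.preconnected b a).exists_isPath
  have hle : G.deleteEdges S ≤ G := G.deleteEdges_le S
  have hpS : ∀ f ∈ p.edges, f ∉ S := fun f hf => by
    have := p.edges_subset_edgeSet hf
    rw [SimpleGraph.edgeSet_deleteEdges] at this
    exact this.2
  have hab : G.Adj a b := heG
  refine ⟨p.edges, hpS, fun w hw => ?_⟩
  by_contra! hlt
  refine hw ⟨a, SimpleGraph.Walk.cons (v := b) hab (p.mapLe hle), s(a, b), ?_, by simp, by simpa using hlt⟩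
  rw [SimpleGraph.Walk.cons_isCycle_iff]
  refine ⟨hp.mapLe hle, ?_⟩
  simpa using fun h => hpS _ h heS

/-- For a finite weighted graph `(V, E, w)` with nonnegative weights
and `S ⊆ E`: if the graph obtained by deleting the edges of `S` is connected, then
the set of repaired weight functions that are nonnegative on edges, agree with `w`
outside `S`, and have no broken cycle, is a compact subset of `ℝ^E` (realized inside
the space of all functions `Sym2 V → ℝ`, with coordinates outside `S` fixed to the
values of `w`). -/
theorem stmt_3 {V : Type*} [Fintype V] [DecidableEq V]
    (G : SimpleGraph V) (w : Sym2 V → ℝ)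
    (hw : ∀ e ∈ G.edgeSet, 0 ≤ w e)
    (S : Set (Sym2 V)) (hS : S ⊆ G.edgeSet)
    (hconn : (G.deleteEdges S).Connected) :
    IsCompact {w' : Sym2 V → ℝ |
        (∀ e ∈ G.edgeSet, 0 ≤ w' e) ∧
        (∀ e ∉ S, w' e = w e) ∧
        ¬ HasBrokenCycle G w'} := by
  have hbound : ∀ e : Sym2 V, ∃ m M : ℝ, ∀ w' : Sym2 V → ℝ, (∀ e ∈ G.edgeSet, 0 ≤ w' e) →
      (∀ e ∉ S, w' e = w e) → ¬ HasBrokenCycle G w' → w' e ∈ Set.Icc m M := by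
    intro e
    by_cases he : e ∈ S
    · obtain ⟨l, hlS, hl⟩ := exists_edges_sum_bound G S hconn (hS he) he
      refine ⟨0, (l.map w).sum, fun w' h0 hEq hB => ⟨h0 e (hS he), (hl w' hB).trans_eq ?_⟩⟩
      exact congrArg List.sum (List.map_congr_left fun f hf => hEq f (hlS f hf))
    · exact ⟨w e, w e, fun w' _ hEq _ => by simp [hEq e he]⟩
  choose m M hmM using hbound
  refine (isCompact_univ_pi fun e => isCompact_Icc (a := m e) (b := M e)).of_isClosed_subset ?_
    fun w' hw' e _ => hmM e w' hw'.1 hw'.2.1 hw'.2.2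
  have h0 : IsClosed {w' : Sym2 V → ℝ | ∀ e ∈ G.edgeSet, 0 ≤ w' e} := by
    simp only [Set.ofPred_forall]
    exact isClosed_iInter fun e => isClosed_iInter fun _ =>
      isClosed_le continuous_const (continuous_apply e)
  have h1 : IsClosed {w' : Sym2 V → ℝ | ∀ e ∉ S, w' e = w e} := by
    simp only [Set.ofPred_forall]
    exact isClosed_iInter fun e => isClosed_iInter fun _ =>
      isClosed_eq (continuous_apply e) continuous_const
  exact h0.inter (h1.inter (isClosed_setOf_not_hasBrokenCycle G))
end

section
/- Let G = (V, E, w) be a finite weighted graph with nonnegative weights whose underlying graph is chordal. If G has a broken cycle, then G has a broken cycle of length 3 (a broken triangle). -/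
/-- A chord of the cycle `c`: an edge of `G` joining two vertices of `c` that is not
an edge of `c` (in a simple graph this is exactly an edge joining two
non-consecutive vertices of the cycle). -/
def CycleHasChord {V : Type*} [DecidableEq V] (G : SimpleGraph V) {u : V}
    (c : G.Walk u u) : Prop :=
  ∃ e ∈ G.edgeSet, e ∉ c.edges ∧ ∀ x ∈ e, x ∈ c.support

/-- A graph is chordal if every cycle of length at least 4 has a chord. -/
def IsChordalGraph {V : Type*} [DecidableEq V] (G : SimpleGraph V) : Prop :=
  ∀ (u : V) (c : G.Walk u u), c.IsCycle → 4 ≤ c.length → CycleHasChord G c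

namespace SimpleGraph.Walk

variable {V : Type*} {G : SimpleGraph V}

/-- A walk through an edge splits at that edge. -/
theorem exists_eq_append_cons_of_mem_edges {a b : V} (p : G.Walk a b) {e : Sym2 V}
    (he : e ∈ p.edges) :
    ∃ (x y : V) (h : G.Adj x y) (q : G.Walk a x) (r : G.Walk y b),
      e = s(x, y) ∧ p = q.append (cons h r) := by
  induction p with
  | nil => simp at he
  | cons h p ih =>
    rw [edges_cons, List.mem_cons] at he
    rcases he with rfl | he
    · exact ⟨_, _, h, nil, p, rfl, rfl⟩
    · obtain ⟨x, y, h', q, r, rfl, rfl⟩ := ih he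
      exact ⟨x, y, h', cons h q, r, rfl, rfl⟩

/-- A walk splits at any two of its vertices, taken in one of the two orders. -/
theorem exists_eq_append_append_of_mem_support [DecidableEq V] {a b x y : V} (p : G.Walk a b)
    (hx : x ∈ p.support) (hy : y ∈ p.support) :
    (∃ (q : G.Walk a x) (r : G.Walk x y) (t : G.Walk y b), p = q.append (r.append t)) ∨
      ∃ (q : G.Walk a y) (r : G.Walk y x) (t : G.Walk x b), p = q.append (r.append t) := by
  have hp := p.take_spec hx
  rw [← hp, mem_support_append_iff] at hy
  rcases hy with hy | hy
  · right
    refine ⟨(p.takeUntil x hx).takeUntil y hy, (p.takeUntil x hx).dropUntil y hy,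
      p.dropUntil x hx, ?_⟩
    rw [append_assoc, take_spec, hp]
  · left
    refine ⟨p.takeUntil x hx, (p.dropUntil x hx).takeUntil y hy,
      (p.dropUntil x hx).dropUntil y hy, ?_⟩
    rw [take_spec, hp]

/-- Replacing a middle segment of a path by an edge between its ends gives a path. -/
theorem IsPath.append_cons_of_append {a b x y : V} {q : G.Walk a x} {r : G.Walk x y}
    {t : G.Walk y b} (hp : (q.append (r.append t)).IsPath) (h : G.Adj x y) :
    (q.append (cons h t)).IsPath := by
  rw [isPath_def] at hp ⊢
  refine hp.sublist ?_
  rw [support_append, support_append, support_append, support_cons, List.tail_cons]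
  refine List.Sublist.append_left ?_ _
  have hr : [y].Sublist r.support.tail := by
    rw [List.singleton_sublist]
    exact end_mem_tail_support (not_nil_of_ne h.ne)
  rw [List.tail_append_of_ne_nil r.support_ne_nil]
  simpa [cons_tail_support] using hr.append_right t.support.tail

end SimpleGraph.Walk

open SimpleGraph Walk

/-- In a chordal graph, an edge that outweighs a path joining its ends and avoiding it
yields a broken triangle. -/
theorem IsChordalGraph.exists_broken_triangle_of_isPath {V : Type*} [DecidableEq V]
    {G : SimpleGraph V} (hG : IsChordalGraph G) (w : Sym2 V → ℝ) {u v : V} (h : G.Adj u v)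
    (p : G.Walk v u) (hp : p.IsPath) (hmem : s(u, v) ∉ p.edges)
    (hlt : (p.edges.map w).sum < w s(u, v)) :
    ∃ (a : V) (c : G.Walk a a) (e : Sym2 V), c.length = 3 ∧ IsTopEdgeOf G w c e := by
  induction hn : p.length using Nat.strong_induction_on generalizing u v with
  | _ n ih =>
    subst hn
    have hc : (cons h p).IsCycle := (cons_isCycle_iff p h).2 ⟨hp, hmem⟩
    have h3 := hc.three_le_length
    rcases h3.eq_or_lt with h3 | h3
    · exact ⟨u, cons h p, s(u, v), h3.symm, hc, by simp, by simpa using hlt⟩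
    obtain ⟨e, heG, hec, hsupp⟩ := hG u _ hc h3
    have key : ∀ x y : V, G.Adj x y → s(x, y) ∉ (cons h p).edges →
        (∃ (q : G.Walk v x) (r : G.Walk x y) (t : G.Walk y u), p = q.append (r.append t)) →
        ∃ (a : V) (c : G.Walk a a) (e : Sym2 V), c.length = 3 ∧ IsTopEdgeOf G w c e := by
      rintro x y hxy hc' ⟨q, r, t, rfl⟩
      simp only [edges_cons, edges_append, List.mem_cons, List.mem_append, not_or] at hc' hmem
      obtain ⟨hne, hq, hr, ht⟩ := hc'
      simp only [edges_append, List.map_append, List.sum_append] at hlt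
      by_cases hw : (r.edges.map w).sum < w s(x, y)
      · refine ih r.length ?_ hxy.symm r hp.of_append_right.of_append_left
          (by rwa [Sym2.eq_swap]) (by rwa [Sym2.eq_swap]) rfl
        by_contra hlen
        simp only [length_append] at hlen
        have hq0 := eq_of_length_eq_zero (p := q) (by omega)
        have ht0 := eq_of_length_eq_zero (p := t) (by omega)
        subst hq0 ht0
        exact hne Sym2.eq_swap
      · refine ih (q.append (cons hxy t)).length ?_ h _ (hp.append_cons_of_append hxy) ?_ ?_ rfl
        · have h0 : r.length ≠ 0 := fun h0 => hxy.ne (eq_of_length_eq_zero h0)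
          have h1 : r.length ≠ 1 := by
            intro h1
            obtain ⟨z, h', r', rfl⟩ := exists_eq_cons_of_ne hxy.ne r
            have h2 := eq_of_length_eq_zero (p := r') (by simpa using h1)
            subst h2
            simp at hr
          simp only [length_append, length_cons]
          omega
        · simp only [edges_cons, edges_append, List.mem_cons, List.mem_append, not_or]
          exact ⟨hmem.1, Ne.symm hne, hmem.2.2⟩
        · simp only [edges_append, edges_cons, List.map_append, List.map_cons, List.sum_append,
            List.sum_cons]
          linarith
    induction e with
    | _ x y =>
      have hmem_p : ∀ z ∈ s(x, y), z ∈ p.support := by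
        intro z hz
        have := hsupp z hz
        rw [support_cons, List.mem_cons] at this
        rcases this with rfl | this
        · exact p.end_mem_support
        · exact this
      rcases p.exists_eq_append_append_of_mem_support (hmem_p x (Sym2.mem_mk_left x y))
        (hmem_p y (Sym2.mem_mk_right x y)) with hs | hs
      · exact key x y heG hec hs
      · exact key y x (G.adj_symm heG) (by rwa [Sym2.eq_swap]) hs

/-- If a finite weighted graph with nonnegative weights is chordal
and has a broken cycle, then it has a broken triangle (a broken cycle of length 3). -/
theorem stmt_4 {V : Type*} [Fintype V] [DecidableEq V]
    (G : SimpleGraph V) (w : Sym2 V → ℝ)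
    (hw : ∀ e ∈ G.edgeSet, 0 ≤ w e)
    (hchordal : IsChordalGraph G)
    (hbroken : HasBrokenCycle G w) :
    ∃ (u : V) (c : G.Walk u u) (e : Sym2 V), c.length = 3 ∧ IsTopEdgeOf G w c e := by
  obtain ⟨a, c, e, hc, he, hlt⟩ := hbroken
  obtain ⟨x, y, h, q, r, rfl, rfl⟩ := c.exists_eq_append_cons_of_mem_edges he
  have hperm : (q.append (cons h r)).edges.Perm (s(x, y) :: (r.append q).edges) := by
    simp only [edges_append, edges_cons]
    exact List.perm_middle.trans (List.perm_append_comm.cons _)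
  have hnodup := hperm.nodup hc.edges_nodup
  have herase := (hperm.erase s(x, y)).trans (by rw [List.erase_cons_head])
  rw [(herase.map w).sum_eq] at hlt
  refine hchordal.exists_broken_triangle_of_isPath w h (r.append q) ?_
    (List.nodup_cons.1 hnodup).1 hlt
  have hs := hc.support_nodup
  rw [support_append, support_cons, List.tail_cons, List.tail_append_of_ne_nil q.support_ne_nil]
    at hs
  rw [isPath_def, support_append]
  exact List.perm_append_comm.nodup hs
end

section
/- Let G = (V, E, w) be a finite weighted graph with nonnegative weights. For each edge uv ∈ E define W(uv) = d_w(u, v) − w(uv), where d_w is the shortest-path distance in G. Then W(e) ≤ 0 for all e, W is a decrease-only solution of the metric repair problem, and for every decrease-only solution W' one has supp(W) ⊆ supp(W'). In particular, W is a decrease-only solution with minimum support size. -/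
/-- Shortest-path distance between `u` and `v` in `(G, w)`: the infimum of the
total `w`-weight of paths from `u` to `v` in `G`. -/
noncomputable def spDist {V : Type*} (G : SimpleGraph V) (w : Sym2 V → ℝ)
    (u v : V) : ℝ :=
  sInf {x : ℝ | ∃ p : G.Walk u v, p.IsPath ∧ x = (p.edges.map w).sum}

open SimpleGraph

lemma edges_sum_nonneg {V : Type*} {G : SimpleGraph V} {w : Sym2 V → ℝ}
    (hw : ∀ e ∈ G.edgeSet, 0 ≤ w e) {u v : V} (p : G.Walk u v) :
    0 ≤ (p.edges.map w).sum := by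
  refine List.sum_nonneg fun x hx => ?_
  obtain ⟨e, he, rfl⟩ := List.mem_map.1 hx
  exact hw e (p.edges_subset_edgeSet he)

lemma exists_eq_append_cons_of_mem_edges {V : Type*} {G : SimpleGraph V} {u v : V}
    (p : G.Walk u v) {e : Sym2 V} (he : e ∈ p.edges) :
    ∃ (x y : V) (h : G.Adj x y) (q : G.Walk u x) (r : G.Walk y v),
      e = s(x, y) ∧ p = q.append (Walk.cons h r) := by
  induction p with
  | nil => simp at he
  | cons h p ih =>
    rw [Walk.edges_cons, List.mem_cons] at he
    rcases he with rfl | he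
    · exact ⟨_, _, h, Walk.nil, p, rfl, rfl⟩
    · obtain ⟨x, y, h', q, r, rfl, rfl⟩ := ih he
      exact ⟨x, y, h', Walk.cons h q, r, rfl, rfl⟩

lemma bddBelow_path_weights {V : Type*} {G : SimpleGraph V} {w : Sym2 V → ℝ}
    (hw : ∀ e ∈ G.edgeSet, 0 ≤ w e) (u v : V) :
    BddBelow {x : ℝ | ∃ p : G.Walk u v, p.IsPath ∧ x = (p.edges.map w).sum} := by
  refine ⟨0, ?_⟩
  rintro _ ⟨p, -, rfl⟩
  exact edges_sum_nonneg hw p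

lemma spDist_nonneg {V : Type*} {G : SimpleGraph V} {w : Sym2 V → ℝ}
    (hw : ∀ e ∈ G.edgeSet, 0 ≤ w e) (u v : V) : 0 ≤ spDist G w u v := by
  refine Real.sInf_nonneg ?_
  rintro _ ⟨p, -, rfl⟩
  exact edges_sum_nonneg hw p

lemma edges_sum_bypass_le {V : Type*} [DecidableEq V] {G : SimpleGraph V} {w : Sym2 V → ℝ}
    (hw : ∀ e ∈ G.edgeSet, 0 ≤ w e) {u v : V} (p : G.Walk u v) :
    (p.bypass.edges.map w).sum ≤ (p.edges.map w).sum := by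
  refine (p.edges_bypass_sublist_edges.map w).sum_le_sum fun x hx => ?_
  obtain ⟨e, he, rfl⟩ := List.mem_map.1 hx
  exact hw e (p.edges_subset_edgeSet he)

lemma spDist_le_edges_sum {V : Type*} [DecidableEq V] {G : SimpleGraph V} {w : Sym2 V → ℝ}
    (hw : ∀ e ∈ G.edgeSet, 0 ≤ w e) {u v : V} (p : G.Walk u v) :
    spDist G w u v ≤ (p.edges.map w).sum :=
  (csInf_le (bddBelow_path_weights hw u v) ⟨p.bypass, p.bypass_isPath, rfl⟩).trans
    (edges_sum_bypass_le hw p)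

lemma le_spDist {V : Type*} [DecidableEq V] {G : SimpleGraph V} {w : Sym2 V → ℝ}
    {u v : V} (huv : G.Reachable u v) {a : ℝ}
    (h : ∀ p : G.Walk u v, a ≤ (p.edges.map w).sum) : a ≤ spDist G w u v := by
  obtain ⟨q⟩ := huv
  refine le_csInf ⟨_, q.bypass, q.bypass_isPath, rfl⟩ ?_
  rintro _ ⟨p, -, rfl⟩
  exact h p

lemma spDist_triangle {V : Type*} [DecidableEq V] {G : SimpleGraph V} {w : Sym2 V → ℝ}
    (hw : ∀ e ∈ G.edgeSet, 0 ≤ w e) {u x v : V}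
    (hux : G.Reachable u x) (hxv : G.Reachable x v) :
    spDist G w u v ≤ spDist G w u x + spDist G w x v := by
  rw [← sub_le_iff_le_add]
  refine le_spDist hux fun p => ?_
  rw [sub_le_comm]
  refine le_spDist hxv fun q => ?_
  have := spDist_le_edges_sum hw (p.append q)
  rw [Walk.edges_append, List.map_append, List.sum_append] at this
  linarith

lemma spDist_le_edges_sum_of_eq_spDist {V : Type*} [DecidableEq V] {G : SimpleGraph V}
    {w w' : Sym2 V → ℝ} (hw : ∀ e ∈ G.edgeSet, 0 ≤ w e)
    (hw' : ∀ u v, G.Adj u v → w' s(u, v) = spDist G w u v) {u v : V} (p : G.Walk u v) :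
    spDist G w u v ≤ (p.edges.map w').sum := by
  induction p with
  | nil => exact spDist_le_edges_sum hw Walk.nil
  | cons h p ih =>
    rw [Walk.edges_cons, List.map_cons, List.sum_cons, hw' _ _ h]
    exact (spDist_triangle hw h.reachable p.reachable).trans (by gcongr)

lemma not_hasBrokenCycle_of_eq_spDist {V : Type*} [DecidableEq V] {G : SimpleGraph V}
    {w w' : Sym2 V → ℝ} (hw : ∀ e ∈ G.edgeSet, 0 ≤ w e)
    (hw' : ∀ u v, G.Adj u v → w' s(u, v) = spDist G w u v) : ¬ HasBrokenCycle G w' := by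
  rintro ⟨a, c, e, -, he, hlt⟩
  obtain ⟨x, y, h, q, r, rfl, rfl⟩ := exists_eq_append_cons_of_mem_edges c he
  have hle := spDist_le_edges_sum_of_eq_spDist hw hw' (r.append q)
  rw [← hw' y x h.symm, Sym2.eq_swap] at hle
  have hsum := ((List.perm_cons_erase he).map w').sum_eq
  simp only [Walk.edges_append, Walk.edges_cons, List.map_append, List.map_cons,
    List.sum_append, List.sum_cons] at hle hlt hsum
  linarith

lemma hasBrokenCycle_of_edges_sum_lt {V : Type*} [DecidableEq V] {G : SimpleGraph V}
    {w : Sym2 V → ℝ} {u v : V} (h : G.Adj u v) {p : G.Walk v u}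
    (hp : p.IsPath) (he : s(u, v) ∉ p.edges) (hlt : (p.edges.map w).sum < w s(u, v)) :
    HasBrokenCycle G w := by
  refine ⟨u, Walk.cons h p, s(u, v), (Walk.cons_isCycle_iff p h).2 ⟨hp, he⟩, ?_, ?_⟩
  · simp
  · simpa using hlt

/-- For a finite weighted graph `(V, E, w)` with nonnegative weights,
the modification `W(uv) = d_w(u,v) - w(uv)` is nonpositive on edges, is a
decrease-only solution of the metric repair problem, and its support is contained in
the support of every decrease-only solution; in particular it is a decrease-only
solution of minimum support size. -/
theorem stmt_5 {V : Type*} [Fintype V] [DecidableEq V]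
    (G : SimpleGraph V) (w : Sym2 V → ℝ)
    (hw : ∀ e ∈ G.edgeSet, 0 ≤ w e)
    (W : Sym2 V → ℝ)
    (hW : ∀ u v, G.Adj u v → W s(u, v) = spDist G w u v - w s(u, v)) :
    (∀ e ∈ G.edgeSet, W e ≤ 0) ∧
    (∀ e ∈ G.edgeSet, 0 ≤ w e + W e) ∧
    ¬ HasBrokenCycle G (fun e => w e + W e) ∧
    (∀ W' : Sym2 V → ℝ,
      (∀ e ∈ G.edgeSet, W' e ≤ 0) →
      (∀ e ∈ G.edgeSet, 0 ≤ w e + W' e) →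
      ¬ HasBrokenCycle G (fun e => w e + W' e) →
      ∀ e ∈ G.edgeSet, W e ≠ 0 → W' e ≠ 0) := by
  refine ⟨?_, ?_, ?_, ?_⟩
  · intro e
    induction e with | _ u v
    intro h
    have := spDist_le_edges_sum hw (Walk.cons (G.mem_edgeSet.1 h) Walk.nil)
    rw [hW u v h]
    simpa using this
  · intro e
    induction e with | _ u v
    intro h
    rw [hW u v h, add_sub_cancel]
    exact spDist_nonneg hw u v
  · exact not_hasBrokenCycle_of_eq_spDist hw fun u v h => by rw [hW u v h, add_sub_cancel]
  · intro W' hW' _ hbroken e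
    induction e with | _ u v
    intro h hne h0
    have hadj : G.Adj v u := (G.mem_edgeSet.1 h).symm
    rw [hW u v h, sub_ne_zero] at hne
    have hle : spDist G w u v ≤ w s(u, v) := by
      simpa using spDist_le_edges_sum hw (Walk.cons hadj.symm Walk.nil)
    obtain ⟨_, ⟨p, hp, rfl⟩, hlt⟩ := exists_lt_of_csInf_lt
      (by exact ⟨_, hadj.symm.toWalk.bypass, hadj.symm.toWalk.bypass_isPath, rfl⟩)
      (show sInf _ < w s(u, v) from lt_of_le_of_ne hle hne)
    have he : s(v, u) ∉ p.edges := fun hmem => by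
      rw [Sym2.eq_swap] at hmem
      refine hlt.not_ge (List.single_le_sum ?_ _ (List.mem_map_of_mem hmem))
      intro x hx
      obtain ⟨e, he, rfl⟩ := List.mem_map.1 hx
      exact hw e (p.edges_subset_edgeSet he)
    refine hbroken (hasBrokenCycle_of_edges_sum_lt hadj hp he ?_)
    rw [Sym2.eq_swap, h0, add_zero]
    refine (List.sum_le_sum fun e he => ?_).trans_lt hlt
    linarith [hW' e (p.edges_subset_edgeSet he)]
end

section
/- Let G = (V, E, w) be a finite weighted graph with nonnegative weights, let k be a natural number, and let e ∈ E. If e is a bottom edge of more than k distinct broken 3-cycles of G, then every increase-only solution W of the metric repair problem with |supp(W)| ≤ k satisfies e ∈ supp(W). -/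
/-- In a weighted graph without broken cycles, every triangle satisfies the triangle inequality. -/
theorem weight_le_add_of_not_hasBrokenCycle {V : Type*} [DecidableEq V] {G : SimpleGraph V}
    {w : Sym2 V → ℝ} (h : ¬ HasBrokenCycle G w) {a b c : V}
    (hab : G.Adj a b) (hbc : G.Adj b c) (hac : G.Adj a c) :
    w s(a, c) ≤ w s(a, b) + w s(b, c) := by
  by_contra! hlt
  have := hab.ne
  have := hbc.ne
  have := hac.ne
  refine h ⟨a, .cons hac (.cons hbc.symm (.cons hab.symm .nil)), s(a, c), ?_, by simp, ?_⟩
  · simp [SimpleGraph.Walk.cons_isCycle_iff, SimpleGraph.Walk.cons_isPath_iff, *]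
    grind
  · simp only [SimpleGraph.Walk.edges_cons, SimpleGraph.Walk.edges_nil, List.erase_cons_head,
      List.map_cons, List.map_nil, List.sum_cons, List.sum_nil, Sym2.eq_swap (a := c) (b := b),
      Sym2.eq_swap (a := b) (b := a)]
    linarith

/-- Let `(V, E, w)` be a finite weighted graph with nonnegative
weights, `k : ℕ`, and `uv ∈ E`. If `uv` is a bottom edge of more than `k` distinct
broken 3-cycles (equivalently, there are more than `k` vertices `x` forming a broken
triangle `u v x` in which `uv` is a bottom edge), then every increase-only solution
`W` of the metric repair problem with `|supp(W)| ≤ k` satisfies `W(uv) ≠ 0`. -/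
theorem stmt_7 {V : Type*} [Fintype V] [DecidableEq V]
    (G : SimpleGraph V) (w : Sym2 V → ℝ)
    (hw : ∀ e ∈ G.edgeSet, 0 ≤ w e)
    (k : ℕ) (u v : V) (huv : G.Adj u v)
    (hmany : k < {x : V | G.Adj u x ∧ G.Adj v x ∧
        (w s(u, v) + w s(v, x) < w s(u, x) ∨
         w s(u, v) + w s(u, x) < w s(v, x))}.ncard)
    (W : Sym2 V → ℝ)
    (hWinc : ∀ e ∈ G.edgeSet, 0 ≤ W e)
    (hWnonneg : ∀ e ∈ G.edgeSet, 0 ≤ w e + W e)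
    (hWsol : ¬ HasBrokenCycle G (fun e => w e + W e))
    (hWcard : {e | e ∈ G.edgeSet ∧ W e ≠ 0}.ncard ≤ k) :
    W s(u, v) ≠ 0 := by
  intro h0
  refine absurd hWcard (not_le.2 (hmany.trans_le ?_))
  refine Set.ncard_le_ncard_of_injOn
    (fun x => if W s(v, x) ≠ 0 then s(v, x) else s(u, x)) ?_ ?_ (Set.toFinite _)
  · rintro x ⟨hux, hvx, hx⟩
    by_cases hv : W s(v, x) = 0
    · simp only [hv, ne_eq, not_true_eq_false, if_false]
      refine ⟨hux, fun hu => ?_⟩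
      have h1 := weight_le_add_of_not_hasBrokenCycle hWsol huv hvx hux
      have h2 := weight_le_add_of_not_hasBrokenCycle hWsol huv.symm hux hvx
      simp only [Sym2.eq_swap (a := v) (b := u), h0, hu, hv] at h1 h2
      rcases hx with hx | hx <;> linarith
    · simp only [hv, ne_eq, not_false_eq_true, if_true]
      exact ⟨hvx, hv⟩
  · rintro x ⟨hux, hvx, -⟩ y ⟨huy, hvy, -⟩ hxy
    have := hux.ne
    have := hvx.ne
    have := huy.ne
    have := hvy.ne
    dsimp only at hxy
    split_ifs at hxy <;> grind
end

section
/- Fix integers n and k with 1 ≤ k and 2k < n, and let D be the associated gadget matrix. For pairwise distinct indices r, s, t in {1, …, n}, the triangle inequality is violated in the form D_{rs} > D_{rt} + D_{ts} if and only if exactly one of r, s is at most k (say a = min(r, s) ≤ k < max(r, s)), t ≤ k, and t > a. In particular, every broken triangle of D has its top edge between {1,…,k} and {k+1,…,n} and its apex vertex in {1,…,k}. -/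
/-- The gadget matrix associated with `k` (used on indices `1, …, n` with
`1 ≤ k` and `2k < n`): `D i j = 0` if `i = j` or both `i, j ≤ k`;
`D i j = 1` if both `i, j > k`; and `D i j = k + 1 - min i j` otherwise. -/
noncomputable def gadget (k : ℕ) (i j : ℕ) : ℝ :=
  if i = j then 0
  else if i ≤ k ∧ j ≤ k then 0
  else if k < i ∧ k < j then 1
  else (k : ℝ) + 1 - (min i j : ℕ)

/-- The entries of the gadget matrix are integers. -/
theorem gadget_eq_intCast (k i j : ℕ) :
    gadget k i j =
      ((if i = j then 0
        else if i ≤ k ∧ j ≤ k then 0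
        else if k < i ∧ k < j then 1
        else (k : ℤ) + 1 - (min i j : ℕ) : ℤ) : ℝ) := by
  unfold gadget
  split_ifs <;> push_cast <;> rfl

/-- For `1 ≤ k`, `2k < n` and pairwise distinct `r, s, t ∈ {1,…,n}`,
the triangle inequality is violated in the form `D r s > D r t + D t s` iff exactly
one of `r, s` is at most `k` (i.e. `min r s ≤ k < max r s`), `t ≤ k`, and
`t > min r s`. In particular every broken triangle of the gadget has its top edge
between `{1,…,k}` and `{k+1,…,n}` and its apex vertex in `{1,…,k}`. -/
theorem stmt_12 (n k : ℕ) (hk : 1 ≤ k) (hn : 2 * k < n)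
    (r s t : ℕ)
    (hr : r ∈ Finset.Icc 1 n) (hs : s ∈ Finset.Icc 1 n) (ht : t ∈ Finset.Icc 1 n)
    (hrs : r ≠ s) (hrt : r ≠ t) (hst : s ≠ t) :
    gadget k r t + gadget k t s < gadget k r s ↔
      (min r s ≤ k ∧ k < max r s ∧ t ≤ k ∧ min r s < t) := by
  rw [gadget_eq_intCast, gadget_eq_intCast, gadget_eq_intCast, ← Int.cast_add, Int.cast_lt]
  split_ifs <;> omega
end

section
/- Fix integers n and k with 1 ≤ k and 2k < n, and let D be the associated gadget matrix. Define the symmetric matrix D' by D'_{ij} = |i − j| whenever i, j ≤ k, and D'_{ij} = D_{ij} otherwise. Then D' is an increase-only repair of D: it is symmetric with zero diagonal, D'_{ij} ≥ D_{ij} for all i, j, and D'_{ij} ≤ D'_{il} + D'_{lj} for all indices i, j, l. Moreover D' differs from D in exactly k(k−1)/2 unordered off-diagonal pairs, namely the pairs {i, j} with 1 ≤ i < j ≤ k. -/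
/-- The repaired gadget matrix: `D' i j = |i - j|` if both `i, j ≤ k`, and
`D' i j = D i j` otherwise. -/
noncomputable def gadget' (k : ℕ) (i j : ℕ) : ℝ :=
  if i ≤ k ∧ j ≤ k then |(i : ℝ) - (j : ℝ)| else gadget k i j

/-- `gadget'` is the path metric on indices at most `k`. -/
theorem gadget'_of_le_of_le {k i j : ℕ} (hi : i ≤ k) (hj : j ≤ k) :
    gadget' k i j = |(i : ℝ) - j| := by
  simp [gadget', hi, hj]

theorem gadget'_of_le_of_lt {k i j : ℕ} (hi : i ≤ k) (hj : k < j) :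
    gadget' k i j = (k : ℝ) + 1 - i := by
  have hij : i < j := by omega
  simp [gadget', gadget, hij.ne, hij.le, hi.not_gt, hj.not_ge]

theorem gadget'_of_lt_of_lt {k i j : ℕ} (hi : k < i) (hj : k < j) :
    gadget' k i j = if i = j then 0 else 1 := by
  simp [gadget', gadget, hi, hj, hj.not_ge]

theorem gadget_comm (k i j : ℕ) : gadget k i j = gadget k j i := by
  simp only [gadget, eq_comm (a := i), and_comm (a := i ≤ k), and_comm (a := k < i), min_comm i]

theorem gadget'_comm (k i j : ℕ) : gadget' k i j = gadget' k j i := by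
  simp only [gadget', gadget_comm k i j, and_comm (a := i ≤ k), abs_sub_comm (i : ℝ)]

theorem gadget'_self (k i : ℕ) : gadget' k i i = 0 := by
  simp [gadget', gadget]

theorem gadget_eq_zero {k i j : ℕ} (hi : i ≤ k) (hj : j ≤ k) : gadget k i j = 0 := by
  simp [gadget, hi, hj]

theorem gadget_le_gadget' (k i j : ℕ) : gadget k i j ≤ gadget' k i j := by
  by_cases h : i ≤ k ∧ j ≤ k
  · rw [gadget_eq_zero h.1 h.2, gadget'_of_le_of_le h.1 h.2]
    positivity
  · simp [gadget', h]

theorem gadget'_triangle (k i j l : ℕ) : gadget' k i j ≤ gadget' k i l + gadget' k l j := by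
  have cast_le {m : ℕ} (h : m ≤ k) : (m : ℝ) ≤ k := by exact_mod_cast h
  rcases le_or_gt i k with hi | hi <;> rcases le_or_gt j k with hj | hj <;>
    rcases le_or_gt l k with hl | hl
  · simp only [gadget'_of_le_of_le, *]
    exact abs_sub_le _ _ _
  · rw [gadget'_comm k l j, gadget'_of_le_of_le hi hj, gadget'_of_le_of_lt hi hl,
      gadget'_of_le_of_lt hj hl, abs_le]
    constructor <;> linarith [cast_le hi, cast_le hj]
  · rw [gadget'_of_le_of_lt hi hj, gadget'_of_le_of_le hi hl, gadget'_of_le_of_lt hl hj]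
    linarith [neg_abs_le ((i : ℝ) - l)]
  · rw [gadget'_of_le_of_lt hi hj, gadget'_of_le_of_lt hi hl, gadget'_of_lt_of_lt hl hj]
    split_ifs <;> linarith
  · rw [gadget'_comm k i j, gadget'_comm k i l, gadget'_of_le_of_lt hj hi,
      gadget'_of_le_of_lt hl hi, gadget'_of_le_of_le hl hj]
    linarith [le_abs_self ((l : ℝ) - j)]
  · rw [gadget'_comm k i j, gadget'_comm k l j, gadget'_of_le_of_lt hj hi,
      gadget'_of_le_of_lt hj hl, gadget'_of_lt_of_lt hi hl]
    split_ifs <;> linarith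
  · rw [gadget'_comm k i l, gadget'_of_lt_of_lt hi hj, gadget'_of_le_of_lt hl hi,
      gadget'_of_le_of_lt hl hj]
    split_ifs <;> linarith [cast_le hl]
  · simp only [gadget'_of_lt_of_lt, *]
    split_ifs <;> first | omega | norm_num

theorem gadget'_ne_gadget_iff {k i j : ℕ} (hij : i < j) :
    gadget' k i j ≠ gadget k i j ↔ j ≤ k := by
  by_cases hj : j ≤ k
  · have hi : i ≤ k := hij.le.trans hj
    simp [gadget'_of_le_of_le hi hj, gadget_eq_zero hi hj, hj, sub_eq_zero, hij.ne]
  · simp [gadget', hj]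

theorem ncard_setOf_lt_le (k : ℕ) :
    {p : ℕ × ℕ | 1 ≤ p.1 ∧ p.1 < p.2 ∧ p.2 ≤ k}.ncard = k * (k - 1) / 2 := by
  have hset : {p : ℕ × ℕ | 1 ≤ p.1 ∧ p.1 < p.2 ∧ p.2 ≤ k} =
      (fun q : Σ _ : ℕ, ℕ => (q.2 + 1, q.1 + 1)) ''
        ((Finset.range k).sigma Finset.range : Finset (Σ _ : ℕ, ℕ)) := by
    ext ⟨a, b⟩
    simp only [Set.mem_ofPred_eq, Set.mem_image, Finset.mem_coe, Finset.mem_sigma,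
      Finset.mem_range, Prod.mk.injEq]
    constructor
    · rintro ⟨ha, hab, hb⟩
      exact ⟨⟨b - 1, a - 1⟩, by dsimp only; omega, by dsimp only; omega, by dsimp only; omega⟩
    · rintro ⟨⟨x, y⟩, ⟨hx, hy⟩, rfl, rfl⟩
      dsimp only at *
      omega
  have hinj : Function.Injective (fun q : Σ _ : ℕ, ℕ => (q.2 + 1, q.1 + 1)) := by
    rintro ⟨a, b⟩ ⟨c, d⟩ h
    simp_all
  rw [hset, Set.ncard_image_of_injective _ hinj, Set.ncard_coe_finset, Finset.card_sigma]
  simp [Finset.sum_range_id]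

/-- For `1 ≤ k` and `2k < n`, the matrix `D'` (with
`D' i j = |i - j|` for `i, j ≤ k` and `D' = D` otherwise) is an increase-only repair
of the gadget matrix `D` on the indices `{1, …, n}`: it is symmetric with zero
diagonal, entrywise at least `D`, and satisfies all triangle inequalities. Moreover
it differs from `D` in exactly `k(k-1)/2` unordered off-diagonal pairs, namely the
pairs `{i, j}` with `1 ≤ i < j ≤ k`. -/
theorem stmt_13 (n k : ℕ) (hk : 1 ≤ k) (hn : 2 * k < n) :
    (∀ i ∈ Finset.Icc 1 n, ∀ j ∈ Finset.Icc 1 n, gadget' k i j = gadget' k j i) ∧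
    (∀ i ∈ Finset.Icc 1 n, gadget' k i i = 0) ∧
    (∀ i ∈ Finset.Icc 1 n, ∀ j ∈ Finset.Icc 1 n, gadget k i j ≤ gadget' k i j) ∧
    (∀ i ∈ Finset.Icc 1 n, ∀ j ∈ Finset.Icc 1 n, ∀ l ∈ Finset.Icc 1 n,
      gadget' k i j ≤ gadget' k i l + gadget' k l j) ∧
    (∀ i ∈ Finset.Icc 1 n, ∀ j ∈ Finset.Icc 1 n, i < j →
      (gadget' k i j ≠ gadget k i j ↔ j ≤ k)) ∧
    {p : ℕ × ℕ | 1 ≤ p.1 ∧ p.1 < p.2 ∧ p.2 ≤ n ∧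
      gadget' k p.1 p.2 ≠ gadget k p.1 p.2}.ncard = k * (k - 1) / 2 := by
  refine ⟨fun i _ j _ => gadget'_comm k i j, fun i _ => gadget'_self k i,
    fun i _ j _ => gadget_le_gadget' k i j, fun i _ j _ l _ => gadget'_triangle k i j l,
    fun i _ j _ hij => gadget'_ne_gadget_iff hij, ?_⟩
  rw [← ncard_setOf_lt_le k]
  congr 1
  ext ⟨a, b⟩
  simp only [Set.mem_ofPred_eq]
  constructor
  · rintro ⟨ha, hab, -, h⟩
    exact ⟨ha, hab, (gadget'_ne_gadget_iff hab).1 h⟩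
  · rintro ⟨ha, hab, hb⟩
    exact ⟨ha, hab, by omega, (gadget'_ne_gadget_iff hab).2 hb⟩
end
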